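/- arXiv:math/9412230 — 2 statements merged into one kernel-verified Lean document; each statement's English description precedes it below -/
import Mathlib

section
/- Let S = Sym(ω). Suppose ⟨λ_n : n < ω⟩ is a strictly increasing sequence of regular cardinals such that for each n, S can be written as the union of a chain of λ_n proper subgroups. Let D be a nonprincipal ultrafilter on ω and suppose λ is the true cofinality of the ultraproduct ∏_n λ_n / D (i.e., λ is regular and there is a <_D-increasing, <_D-cofinal sequence of length λ in ∏_n λ_n). Then S can be written as the union of a chain of λ proper subgroups. -/
/-- `S = Sym(ω)` is the union of a chain of `κ` proper subgroups,
indexed by the ordinals below `κ.ord`. -/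
def SymUnionChain (κ : Cardinal) : Prop :=
  ∃ G : Ordinal → Subgroup (Equiv.Perm ℕ),
    (∀ i j : Ordinal, i ≤ j → G i ≤ G j) ∧
    (∀ i < κ.ord, G i ≠ ⊤) ∧
    (∀ g : Equiv.Perm ℕ, ∃ i < κ.ord, g ∈ G i)

/-- `κ ∈ CF(S)`: `κ` is regular and `Sym(ω)` is the union of a chain of `κ`
proper subgroups. -/
def MemCF (κ : Cardinal) : Prop :=
  κ.IsRegular ∧ SymUnionChain κ

/-- `K` contains every permutation supported in `A`. -/
def ContainsSym (K : Subgroup (Equiv.Perm ℕ)) (A : Set ℕ) : Prop :=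
  ∀ g : Equiv.Perm ℕ, (∀ a, a ∉ A → g a = a) → g ∈ K

theorem ContainsSym.of_conj {K : Subgroup (Equiv.Perm ℕ)} {A B : Set ℕ}
    (hB : ContainsSym K B) {w : Equiv.Perm ℕ} (hw : w ∈ K)
    (h : ∀ a ∈ A, w a ∈ B) : ContainsSym K A := by
  intro g hg
  have h1 : w * g * w⁻¹ ∈ K := by
    apply hB
    intro b hb
    have h2 : w.symm b ∉ A := fun h' => hb (by simpa using h _ h')
    simp [Equiv.Perm.mul_apply, hg _ h2]
  have h3 : w⁻¹ * (w * g * w⁻¹) * w ∈ K := K.mul_mem (K.mul_mem (K.inv_mem hw) h1) hw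
  simpa [mul_assoc] using h3

theorem Set.Infinite.nonempty_equiv_of_infinite {α : Type*} [Countable α] {A : Set ℕ} (hA : A.Infinite)
    [Infinite α] : Nonempty (α ≃ A) := by
  have := hA.to_subtype
  exact nonempty_equiv_of_countable

theorem Set.Infinite.exists_infinite_split {A : Set ℕ} (hA : A.Infinite) :
    ∃ B ⊆ A, B.Infinite ∧ (A \ B).Infinite := by
  obtain ⟨e⟩ := hA.nonempty_equiv_of_infinite (α := ℕ ⊕ ℕ)
  refine ⟨Set.range fun n => (e (Sum.inl n) : ℕ), ?_, ?_, ?_⟩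
  · rintro _ ⟨n, rfl⟩
    exact (e _).2
  · refine Set.infinite_range_of_injective fun m n h => ?_
    simpa using e.injective (Subtype.ext h)
  · refine Set.Infinite.mono (s := Set.range fun n => (e (Sum.inr n) : ℕ)) ?_
      (Set.infinite_range_of_injective fun m n h => ?_)
    · rintro _ ⟨n, rfl⟩
      refine ⟨(e _).2, ?_⟩
      rintro ⟨m, h⟩
      simpa using e.injective (Subtype.ext h)
    · simpa using e.injective (Subtype.ext h)

/-- A partial injection of `ℕ` whose domain and range are coinfinite extends to a permutation. -/
theorem exists_perm_eqOn {A : Set ℕ} {f : ℕ → ℕ} (hf : Set.InjOn f A) (hA : Aᶜ.Infinite)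
    (hfA : (f '' A)ᶜ.Infinite) : ∃ k : Equiv.Perm ℕ, Set.EqOn k f A := by
  classical
  have := hA.to_subtype
  obtain ⟨e⟩ := hfA.nonempty_equiv_of_infinite (α := (Aᶜ : Set ℕ))
  let e₁ : {x // x ∈ A} ≃ {x // x ∈ f '' A} := Equiv.Set.imageOfInjOn f A hf
  let e₂ : {x // x ∉ A} ≃ {x // x ∉ f '' A} := e
  refine ⟨Equiv.subtypeCongr e₁ e₂, fun a ha => ?_⟩
  simp [Equiv.subtypeCongr, Equiv.sumCompl_symm_apply_of_pos ha, e₁, Equiv.Set.imageOfInjOn]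

theorem exists_perm_image {A B : Set ℕ} (hA : A.Infinite) (hA' : Aᶜ.Infinite)
    (hB : B.Infinite) (hB' : Bᶜ.Infinite) : ∃ k : Equiv.Perm ℕ, ∀ a, k a ∈ B ↔ a ∈ A := by
  classical
  have := hA.to_subtype
  have := hA'.to_subtype
  obtain ⟨e₁⟩ := hB.nonempty_equiv_of_infinite (α := A)
  obtain ⟨e₂⟩ := hB'.nonempty_equiv_of_infinite (α := (Aᶜ : Set ℕ))
  let e₁' : {x // x ∈ A} ≃ {x // x ∈ B} := e₁
  let e₂' : {x // x ∉ A} ≃ {x // x ∉ B} := e₂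
  refine ⟨Equiv.subtypeCongr e₁' e₂', fun a => ?_⟩
  by_cases ha : a ∈ A
  · simp [Equiv.subtypeCongr, Equiv.sumCompl_symm_apply_of_pos ha, ha]
  · simpa [Equiv.subtypeCongr, Equiv.sumCompl_symm_apply_of_neg ha, ha] using (e₂' ⟨a, ha⟩).2

theorem exists_perm_image_fixing {Z P Q : Set ℕ} (hPZ : P ⊆ Z) (hP : P.Infinite)
    (hZP : (Z \ P).Infinite) (hQZ : Q ⊆ Z) (hQ : Q.Infinite) (hZQ : (Z \ Q).Infinite) :
    ∃ k : Equiv.Perm ℕ, (∀ a, a ∉ Z → k a = a) ∧ ∀ a, k a ∈ Q → a ∈ P := by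
  classical
  have := hP.to_subtype
  obtain ⟨e⟩ := hQ.nonempty_equiv_of_infinite (α := P)
  let f : ℕ → ℕ := fun a => if h : a ∈ P then e ⟨a, h⟩ else a
  have hfP : ∀ a (h : a ∈ P), f a = e ⟨a, h⟩ := fun a h => dif_pos h
  have hfQ : ∀ a ∈ P, f a ∈ Q := fun a h => by rw [hfP a h]; exact (e _).2
  have hfZ : ∀ a ∉ Z, f a = a := fun a h => dif_neg fun h' => h (hPZ h')
  have hinj : Set.InjOn f (P ∪ Zᶜ) := by
    rintro a (ha | ha) b (hb | hb) hab
    · rw [hfP a ha, hfP b hb] at hab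
      simpa using e.injective (Subtype.ext hab)
    · rw [hfZ b hb] at hab
      exact absurd (hQZ (hab ▸ hfQ a ha)) hb
    · rw [hfZ a ha] at hab
      exact absurd (hQZ (hab ▸ hfQ b hb)) ha
    · rwa [hfZ a ha, hfZ b hb] at hab
  have hdom : (P ∪ Zᶜ)ᶜ.Infinite := by
    refine hZP.mono ?_
    rintro a ⟨haZ, haP⟩ (h | h)
    exacts [haP h, h haZ]
  have hran : (f '' (P ∪ Zᶜ))ᶜ.Infinite := by
    refine hZQ.mono ?_
    rintro _ ⟨haZ, haQ⟩ ⟨a, h | h, rfl⟩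
    · exact haQ (hfQ a h)
    · exact h (hfZ a h ▸ haZ)
  obtain ⟨k, hk⟩ := exists_perm_eqOn hinj hdom hran
  refine ⟨k, fun a ha => ?_, fun a ha => ?_⟩
  · rw [hk (Or.inr ha), hfZ a ha]
  · obtain ⟨b, hb⟩ := e.surjective ⟨k a, ha⟩
    have h : k b = k a := by rw [hk (Or.inl b.2), hfP b b.2, hb]
    exact k.injective h ▸ b.2

theorem ContainsSym.compl_of_subset {K : Subgroup (Equiv.Perm ℕ)} {Z Q P : Set ℕ}
    (hKZ : ContainsSym K Z) (hKQ : ContainsSym K Qᶜ) (hQZ : Q ⊆ Z) (hQ : Q.Infinite)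
    (hZQ : (Z \ Q).Infinite) (hPZ : P ⊆ Z) (hP : P.Infinite) : ContainsSym K Pᶜ := by
  obtain ⟨R, hRP, hR, hPR⟩ := hP.exists_infinite_split
  obtain ⟨k, hkZ, hkR⟩ := exists_perm_image_fixing (hRP.trans hPZ) hR
    (hPR.mono (Set.sdiff_subset_sdiff_left hPZ)) hQZ hQ hZQ
  have h : ContainsSym K Rᶜ := hKQ.of_conj (hKZ k hkZ) fun a ha h' => ha (hkR a h')
  exact fun g hg => h g fun a ha => hg a fun h' => h' (hRP (not_not.1 ha))

/-- Every permutation of `ℕ` is a product of two permutations with infinitely many fixed points. -/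
theorem exists_mul_eq_infinite_fixed (g : Equiv.Perm ℕ) :
    ∃ k l : Equiv.Perm ℕ, g = k * l ∧ {a | k a = a}.Infinite ∧ {a | l a = a}.Infinite := by
  classical
  obtain ⟨M, hM, hMg⟩ : ∃ M : Set ℕ, M.Infinite ∧ (M ∪ g '' M)ᶜ.Infinite := by
    obtain ⟨A, -, hA, hA'⟩ := (Set.infinite_univ (α := ℕ)).exists_infinite_split
    obtain ⟨B, hBA, hB, hC⟩ := hA'.exists_infinite_split
    have hsub : (Set.univ \ A) \ B ⊆ (A ∪ g '' A)ᶜ ∪ (B ∪ g '' B)ᶜ := by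
      rintro c ⟨⟨-, hcA⟩, hcB⟩
      by_cases h : c ∈ g '' A
      · right
        rintro (h' | ⟨b, hb, rfl⟩)
        · exact hcB h'
        · obtain ⟨a, ha, hab⟩ := h
          obtain rfl := g.injective hab
          exact (hBA hb).2 ha
      · left
        rintro (h' | h')
        exacts [hcA h', h h']
    rcases Set.infinite_union.1 (hC.mono hsub) with h | h
    exacts [⟨A, hA, h⟩, ⟨B, hB, h⟩]
  obtain ⟨P, hPM, hP, hP'⟩ := hMg.exists_infinite_split
  let f : ℕ → ℕ := fun a => if a ∈ M then g a else a
  have hfM : ∀ a ∈ M, f a = g a := fun a h => if_pos h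
  have hfP : ∀ a ∈ P, f a = a := fun a h => if_neg fun h' => hPM h (Or.inl h')
  have hinj : Set.InjOn f (M ∪ P) := by
    rintro a (ha | ha) b (hb | hb) hab
    · rw [hfM a ha, hfM b hb] at hab
      exact g.injective hab
    · rw [hfM a ha, hfP b hb] at hab
      exact absurd (Or.inr ⟨a, ha, hab⟩) (hPM hb)
    · rw [hfP a ha, hfM b hb] at hab
      exact absurd (Or.inr ⟨b, hb, hab.symm⟩) (hPM ha)
    · rwa [hfP a ha, hfP b hb] at hab
  have hdom : (M ∪ P)ᶜ.Infinite := by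
    refine hP'.mono ?_
    rintro a ⟨ha, haP⟩ (h | h)
    exacts [ha (Or.inl h), haP h]
  have hran : (f '' (M ∪ P))ᶜ.Infinite := by
    refine hP'.mono ?_
    rintro _ ⟨ha, haP⟩ ⟨a, h | h, rfl⟩
    · exact ha (Or.inr ⟨a, h, (hfM a h).symm⟩)
    · exact haP ((hfP a h).symm ▸ h)
  obtain ⟨k, hk⟩ := exists_perm_eqOn hinj hdom hran
  refine ⟨k, k⁻¹ * g, by simp, hP.mono fun a ha => ?_, hM.mono fun a ha => ?_⟩
  · exact (hk (Or.inr ha)).trans (hfP a ha)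
  · have h : k a = g a := (hk (Or.inl ha)).trans (hfM a ha)
    simp [Equiv.Perm.mul_apply, ← h]

/-- Finitely many permutations together with `Sym(Z)` generate `Sym(ω)`. -/
theorem exists_finset_eq_top_of_containsSym {Z : Set ℕ} (hZ : Z.Infinite) (hZ' : Zᶜ.Infinite) :
    ∃ T : Finset (Equiv.Perm ℕ), ∀ K : Subgroup (Equiv.Perm ℕ), (∀ g ∈ T, g ∈ K) →
      ContainsSym K Z → K = ⊤ := by
  classical
  obtain ⟨Q, hQZ, hQ, hZQ⟩ := hZ.exists_infinite_split
  obtain ⟨R, hRZ, hR, hZR⟩ := hZ'.exists_infinite_split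
  obtain ⟨y, hy⟩ := exists_perm_image hZ' (by rwa [compl_compl]) hZ hZ'
  obtain ⟨v, hv⟩ := exists_perm_image (A := Qᶜ) (hZQ.mono fun a h => h.2)
    (by rwa [compl_compl]) hZ hZ'
  obtain ⟨w, hw⟩ := exists_perm_image (A := Rᶜ) (hZR.mono fun a h => h.2)
    (by rwa [compl_compl]) hZ hZ'
  refine ⟨{y, v, w}, fun K hT hK => ?_⟩
  have hKZ' := hK.of_conj (hT y (by simp)) fun a => (hy a).2
  have hKQ := hK.of_conj (hT v (by simp)) fun a => (hv a).2
  have hKR := hK.of_conj (hT w (by simp)) fun a => (hw a).2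
  have key : ∀ g : Equiv.Perm ℕ, {a | g a = a}.Infinite → g ∈ K := by
    intro g hg
    rw [← Set.inter_union_compl {a | g a = a} Z] at hg
    rcases Set.infinite_union.1 hg with h | h
    · exact hK.compl_of_subset hKQ hQZ hQ hZQ Set.inter_subset_right h g
        fun a ha => (not_not.1 ha).1
    · exact hKZ'.compl_of_subset hKR hRZ hR hZR Set.inter_subset_right h g
        fun a ha => (not_not.1 ha).1
  refine eq_top_iff.2 fun g _ => ?_
  obtain ⟨k, l, rfl, hk, hl⟩ := exists_mul_eq_infinite_fixed g
  exact K.mul_mem (key k hk) (key l hl)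

/-- Any permutation of `{0} × α` is a commutator in `Sym(ℤ × α)`. -/
theorem exists_commutator_eq {α : Type*} (h : Equiv.Perm α) :
    ∃ p t : Equiv.Perm (ℤ × α), (∀ a, (p * t * p⁻¹ * t⁻¹) (0, a) = (0, h a)) ∧
      ∀ (n : ℤ) (a : α), n ≠ 0 → (p * t * p⁻¹ * t⁻¹) (n, a) = (n, a) := by
  let p : Equiv.Perm (ℤ × α) := Equiv.prodCongrRight fun n => if 0 ≤ n then h else 1
  let t : Equiv.Perm (ℤ × α) := Equiv.prodCongrLeft fun _ => Equiv.addRight 1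
  have hp : ∀ n a, p (n, a) = (n, (if 0 ≤ n then h else 1) a) := fun n a => rfl
  have ht : ∀ n a, t (n, a) = (n + 1, a) := fun n a => rfl
  have hp' : ∀ n a, p⁻¹ (n, a) = (n, (if 0 ≤ n then h else 1)⁻¹ a) := fun n a => by
    rw [Equiv.Perm.inv_eq_iff_eq, hp]; simp
  have ht' : ∀ n a, t⁻¹ (n, a) = (n - 1, a) := fun n a => by
    rw [Equiv.Perm.inv_eq_iff_eq, ht]; simp
  refine ⟨p, t, fun a => ?_, fun n a hn => ?_⟩
  · simp [Equiv.Perm.mul_apply, hp, ht, hp', ht']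
  · simp only [Equiv.Perm.mul_apply, hp, ht, hp', ht', sub_add_cancel]
    rcases lt_or_gt_of_ne hn with h0 | h0
    · simp [show ¬ 0 ≤ n by omega, show ¬ 1 ≤ n by omega]
    · simp [show 0 ≤ n by omega, show 1 ≤ n by omega]

/-- If `U` induces the full symmetric group on `A ⊕ B` and contains the permutation exchanging
the two copies of `B`, then it contains all commutators of permutations of `A`. -/
theorem commutator_mem {A B : Type*} (e : (A ⊕ B) ⊕ B ≃ ℕ) {U : Subgroup (Equiv.Perm ℕ)}
    {x : Equiv.Perm ℕ} (hx : x ∈ U) (hxA : ∀ a, x (e (.inl (.inl a))) = e (.inl (.inl a)))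
    (hxB : ∀ b, x (e (.inl (.inr b))) = e (.inr b))
    (hxB' : ∀ b, x (e (.inr b)) = e (.inl (.inr b)))
    (hU : ∀ f : Equiv.Perm (A ⊕ B), ∃ u ∈ U, ∀ k, u (e (.inl k)) = e (.inl (f k)))
    {c : Equiv.Perm ℕ} {p t : Equiv.Perm A}
    (hcA : ∀ a, c (e (.inl (.inl a))) = e (.inl (.inl ((p * t * p⁻¹ * t⁻¹) a))))
    (hcB : ∀ b, c (e (.inl (.inr b))) = e (.inl (.inr b)))
    (hcB' : ∀ b, c (e (.inr b)) = e (.inr b)) : c ∈ U := by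
  have hinr : ∀ (f : Equiv.Perm (A ⊕ B)) (u : Equiv.Perm ℕ),
      (∀ k, u (e (.inl k)) = e (.inl (f k))) → ∀ b, ∃ b', u (e (.inr b)) = e (.inr b') := by
    intro f u hu b
    obtain ⟨k | b', hk⟩ := e.surjective (u (e (.inr b)))
    · have h := hu (f⁻¹ k)
      rw [show f (f⁻¹ k) = k from f.apply_symm_apply k, hk] at h
      simpa using e.injective (u.injective h)
    · exact ⟨b', hk.symm⟩
  obtain ⟨u, huU, hu⟩ := hU (Equiv.sumCongr p 1)
  obtain ⟨v, hvU, hv⟩ := hU (Equiv.sumCongr t 1)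
  have huB := hinr _ u hu
  have hvB := hinr _ v hv
  let w : Equiv.Perm ℕ := x * v * x
  have hwA : ∀ a, w (e (.inl (.inl a))) = e (.inl (.inl (t a))) := by
    intro a; simp [w, Equiv.Perm.mul_apply, hxA, hv]
  have hwB' : ∀ b, w (e (.inr b)) = e (.inr b) := by
    intro b; simp [w, Equiv.Perm.mul_apply, hxB', hv, hxB]
  have hwB : ∀ b, ∃ b', w (e (.inl (.inr b))) = e (.inl (.inr b')) := by
    intro b
    obtain ⟨b', hb'⟩ := hvB b
    exact ⟨b', by simp [w, Equiv.Perm.mul_apply, hxB, hb', hxB']⟩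
  have huw : u * w = c * (w * u) := by
    ext n
    obtain ⟨(a | b) | b, rfl⟩ := e.surjective n
    · simp [Equiv.Perm.mul_apply, hwA, hu, hcA]
    · obtain ⟨b', hb'⟩ := hwB b
      simp [Equiv.Perm.mul_apply, hu, hcB, hb']
    · obtain ⟨b', hb'⟩ := huB b
      simp [Equiv.Perm.mul_apply, hwB', hb', hcB']
  have hwU : w ∈ U := U.mul_mem (U.mul_mem hx hvU) hx
  rw [eq_mul_inv_of_mul_eq huw.symm]
  exact U.mul_mem (U.mul_mem huU hwU) (U.inv_mem (U.mul_mem hwU huU))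

/-- Finitely many permutations together with a group inducing the full symmetric group on
a moiety generate `Sym(ω)` (Macpherson–Neumann). -/
theorem exists_finset_eq_top_of_induces {j : ℕ → ℕ} (hj : j.Injective)
    (hj' : (Set.range j)ᶜ.Infinite) :
    ∃ T : Finset (Equiv.Perm ℕ), ∀ U : Subgroup (Equiv.Perm ℕ), (∀ g ∈ T, g ∈ U) →
      (∀ f : Equiv.Perm ℕ, ∃ u ∈ U, ∀ k, u (j k) = j (f k)) → U = ⊤ := by
  classical
  obtain ⟨e₀⟩ : Nonempty ((ℤ × ℕ) ⊕ ℕ ≃ ℕ) := nonempty_equiv_of_countable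
  obtain ⟨e₁⟩ := hj'.nonempty_equiv_of_infinite (α := ℕ)
  let e : ((ℤ × ℕ) ⊕ ℕ) ⊕ ℕ ≃ ℕ :=
    (Equiv.sumCongr (e₀.trans (Equiv.ofInjective j hj)) e₁).trans
      (Equiv.Set.sumCompl (Set.range j))
  have he : ∀ k, e (.inl k) = j (e₀ k) := fun k => rfl
  let s : Equiv.Perm (((ℤ × ℕ) ⊕ ℕ) ⊕ ℕ) :=
    (Equiv.sumAssoc _ _ _).trans ((Equiv.sumCongr (Equiv.refl _) (Equiv.sumComm _ _)).trans
      (Equiv.sumAssoc _ _ _).symm)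
  let x : Equiv.Perm ℕ := e.permCongr s
  let i : ℕ → ℕ := fun k => e (.inl (.inl (0, k)))
  have hi : i.Injective := fun a b h => by simpa [i] using h
  have hi' : (Set.range i)ᶜ.Infinite := by
    refine Set.Infinite.mono (s := Set.range fun b => e (.inr b)) ?_
      (Set.infinite_range_of_injective fun a b h => by simpa using h)
    rintro _ ⟨b, rfl⟩ ⟨a, h⟩
    simpa using e.injective h
  obtain ⟨T, hT⟩ := exists_finset_eq_top_of_containsSym (Set.infinite_range_of_injective hi) hi'
  refine ⟨insert x T, fun U hTU hU => hT U (fun g hg => hTU g (by simp [hg])) fun c hc => ?_⟩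
  have hci : ∀ k, c (i k) ∈ Set.range i := by
    intro k
    by_contra h
    exact h ⟨k, (c.injective (hc _ h)).symm⟩
  have hci' : ∀ k, c.symm (i k) ∈ Set.range i := by
    intro k
    by_contra h
    exact h ⟨k, (c.apply_symm_apply _).symm.trans (hc _ h)⟩
  choose q hq using hci
  choose r hr using hci'
  let h : Equiv.Perm ℕ := ⟨q, r, fun k => hi (by rw [hr, hq, Equiv.symm_apply_apply]),
    fun k => hi (by rw [hq, hr, Equiv.apply_symm_apply])⟩
  have hh : ∀ k, c (i k) = i (h k) := fun k => (hq k).symm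
  obtain ⟨p, t, hpt, hpt'⟩ := exists_commutator_eq h
  refine commutator_mem e (hTU x (by simp)) (fun a => ?_) (fun b => ?_) (fun b => ?_)
    (fun f => ?_) (p := p) (t := t) ?_ (fun b => hc _ ?_) (fun b => hc _ ?_)
  · simp [x, s]
  · simp [x, s]
  · simp [x, s]
  · obtain ⟨u, hu, huf⟩ := hU (e₀.permCongr f)
    exact ⟨u, hu, fun k => by rw [he, he, huf]; simp⟩
  · rintro ⟨n, a⟩
    by_cases hn : n = 0
    · subst hn
      rw [hpt]
      exact hh a
    · rw [hpt' n a hn]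
      refine hc _ ?_
      rintro ⟨k, hk⟩
      have := e.injective hk
      simp only [Sum.inl.injEq, Prod.mk.injEq] at this
      exact hn this.1.symm
  · rintro ⟨k, hk⟩
    simpa using e.injective hk
  · rintro ⟨k, hk⟩
    simpa using e.injective hk

theorem exists_index_forall_mem {κ : Cardinal} {G : Ordinal → Subgroup (Equiv.Perm ℕ)}
    (hG : ∀ i j : Ordinal, i ≤ j → G i ≤ G j) (hGS : ∀ g, ∃ i < κ.ord, g ∈ G i)
    (T : Finset (Equiv.Perm ℕ)) {i : Ordinal} (hi : i < κ.ord) :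
    ∃ j < κ.ord, i ≤ j ∧ ∀ g ∈ T, g ∈ G j := by
  classical
  induction T using Finset.induction_on with
  | empty => exact ⟨i, hi, le_rfl, by simp⟩
  | insert a T _ ih =>
    obtain ⟨j, hj, hij, hT⟩ := ih
    obtain ⟨k, hk, hak⟩ := hGS a
    refine ⟨max j k, max_lt hj hk, hij.trans (le_max_left _ _), fun g hg => ?_⟩
    rcases Finset.mem_insert.1 hg with rfl | hg
    · exact hG _ _ (le_max_right _ _) hak
    · exact hG _ _ (le_max_left _ _) (hT g hg)

/-- No member of a chain of proper subgroups covering `Sym(ω)` induces the full symmetric group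
on a moiety. -/
theorem exists_not_induced {κ : Cardinal} {G : Ordinal → Subgroup (Equiv.Perm ℕ)}
    (hG : ∀ i j : Ordinal, i ≤ j → G i ≤ G j) (hGtop : ∀ i < κ.ord, G i ≠ ⊤)
    (hGS : ∀ g, ∃ i < κ.ord, g ∈ G i) {j : ℕ → ℕ} (hj : j.Injective)
    (hj' : (Set.range j)ᶜ.Infinite) {i : Ordinal} (hi : i < κ.ord) :
    ∃ f : Equiv.Perm ℕ, ∀ u ∈ G i, ¬ ∀ k, u (j k) = j (f k) := by
  obtain ⟨T, hT⟩ := exists_finset_eq_top_of_induces hj hj'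
  obtain ⟨l, hl, hil, hTl⟩ := exists_index_forall_mem hG hGS T hi
  by_contra! h
  refine hGtop l hl (hT _ hTl fun f => ?_)
  obtain ⟨u, hu, huf⟩ := h f
  exact ⟨u, hG _ _ hil hu, huf⟩

/-- The subgroup of permutations lying in `K n` for `D`-almost all `n`. -/
def ultraLimit (D : Ultrafilter ℕ) (K : ℕ → Subgroup (Equiv.Perm ℕ)) :
    Subgroup (Equiv.Perm ℕ) where
  carrier := {g | ∀ᶠ n in (D : Filter ℕ), g ∈ K n}
  mul_mem' ha hb := by
    filter_upwards [ha, hb] with n h₁ h₂ using (K n).mul_mem h₁ h₂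
  one_mem' := Filter.Eventually.of_forall fun n => (K n).one_mem
  inv_mem' ha := by
    filter_upwards [ha] with n h using (K n).inv_mem h

theorem mem_ultraLimit {D : Ultrafilter ℕ} {K : ℕ → Subgroup (Equiv.Perm ℕ)}
    {g : Equiv.Perm ℕ} : g ∈ ultraLimit D K ↔ ∀ᶠ n in (D : Filter ℕ), g ∈ K n :=
  Iff.rfl

/-- Theorem 2.1: if `λ_n ∈ CF(S)` for a strictly increasing sequence of regular
cardinals, `D` is a nonprincipal ultrafilter on `ω`, and `λ` is the true
cofinality of `∏_n λ_n / D`, then `λ ∈ CF(S)`. -/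
theorem stmt_0 (lam : ℕ → Cardinal)
    (hmono : StrictMono lam)
    (hreg : ∀ n, (lam n).IsRegular)
    (hCF : ∀ n, SymUnionChain (lam n))
    (D : Ultrafilter ℕ) (hD : ∀ a : ℕ, D ≠ pure a)
    (lambda : Cardinal) (hlam : lambda.IsRegular)
    (F : Ordinal → ℕ → Ordinal)
    (hFmem : ∀ α < lambda.ord, ∀ n, F α n < (lam n).ord)
    (hFinc : ∀ α β : Ordinal, α < β → β < lambda.ord → {n | F β n ≤ F α n} ∉ D)
    (hFcof : ∀ h : ℕ → Ordinal, (∀ n, h n < (lam n).ord) →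
      ∃ α < lambda.ord, {n | F α n ≤ h n} ∉ D) :
    SymUnionChain lambda := by
  classical
  choose G hG hGtop hGS using hCF
  have hle : ∀ α β : Ordinal, α ≤ β → β < lambda.ord →
      ultraLimit D (fun n => G n (F α n)) ≤ ultraLimit D (fun n => G n (F β n)) := by
    intro α β hαβ hβ g hg
    rcases hαβ.eq_or_lt with rfl | hlt
    · exact hg
    · have h : ∀ᶠ n in (D : Filter ℕ), ¬ F β n ≤ F α n :=
        Ultrafilter.eventually_not.2 (hFinc α β hlt hβ)
      filter_upwards [h, mem_ultraLimit.1 hg] with n h₁ h₂ using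
        hG n _ _ (not_le.1 h₁).le h₂
  refine ⟨fun α => if α < lambda.ord then ultraLimit D (fun n => G n (F α n)) else ⊤,
    fun α β hαβ => ?_, fun α hα => ?_, fun g => ?_⟩
  · by_cases hβ : β < lambda.ord
    · simpa only [if_pos hβ, if_pos (hαβ.trans_lt hβ)] using hle α β hαβ hβ
    · simp only [if_neg hβ, le_top]
  · simp only [if_pos hα]
    have hpair : ∀ n, (Set.range (Nat.pair n))ᶜ.Infinite := by
      intro n
      refine Set.Infinite.mono (s := Set.range (Nat.pair (n + 1))) ?_
        (Set.infinite_range_of_injective fun a b h => (Nat.pair_eq_pair.1 h).2)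
      rintro _ ⟨a, rfl⟩ ⟨b, h⟩
      have := (Nat.pair_eq_pair.1 h).1
      omega
    have hex := fun n => exists_not_induced (hG n) (hGtop n) (hGS n)
      (j := Nat.pair n) (fun a b h => (Nat.pair_eq_pair.1 h).2) (hpair n) (hFmem α hα n)
    choose f hf using hex
    intro htop
    have hmem : Nat.pairEquiv.permCongr (Equiv.prodCongrRight f) ∈
        ultraLimit D (fun n => G n (F α n)) := htop ▸ Subgroup.mem_top _
    obtain ⟨n, hn⟩ := (mem_ultraLimit.1 hmem).exists
    exact hf n _ hn fun k => by
      rw [Equiv.permCongr_apply, show Nat.pairEquiv.symm (Nat.pair n k) = (n, k) from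
        Nat.unpair_pair n k]
      rfl
  · choose h hh hgh using fun n => hGS n g
    obtain ⟨α, hα, hD'⟩ := hFcof h hh
    refine ⟨α, hα, ?_⟩
    simp only [if_pos hα]
    have hev : ∀ᶠ n in (D : Filter ℕ), ¬ F α n ≤ h n := Ultrafilter.eventually_not.2 hD'
    exact mem_ultraLimit.2 (hev.mono fun n hn => hG n _ _ (not_le.1 hn).le (hgh n))
end

section
/- Let {λ_i : i ∈ I} be regular cardinals with |I| < min{λ_i}, and let μ be a regular cardinal with μ > 2^{|I|} such that μ is not a possible cofinality of ∏_{i∈I} λ_i (i.e., no ultrafilter D on I gives tcf(∏ λ_i / D) = μ). If ⟨h_α : α < μ⟩ is any sequence in ∏_{i∈I} λ_i, then there exist X ⊆ μ with |X| = μ and f ∈ ∏_{i∈I} λ_i such that h_α(i) ≤ f(i) for all α ∈ X and i ∈ I. -/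
open Cardinal Ordinal Set

/-- `UnboundedBelow κ P` says that `P` holds at arbitrarily large ordinals below `κ.ord`. -/
def UnboundedBelow (κ : Cardinal.{0}) (P : Ordinal.{0} → Prop) : Prop :=
  ∀ δ < κ.ord, ∃ α, δ ≤ α ∧ α < κ.ord ∧ P α

theorem UnboundedBelow.mono {κ : Cardinal.{0}} {P Q : Ordinal.{0} → Prop}
    (h : UnboundedBelow κ P) (hPQ : ∀ α < κ.ord, P α → Q α) : UnboundedBelow κ Q := fun δ hδ ↦
  let ⟨α, h₁, h₂, h₃⟩ := h δ hδ
  ⟨α, h₁, h₂, hPQ α h₂ h₃⟩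

theorem UnboundedBelow.exists_of_mk_lt {κ : Cardinal.{0}} (hκ : κ.IsRegular) {T : Type}
    (hT : #T < κ) {P : T → Ordinal.{0} → Prop}
    (hP : UnboundedBelow κ fun α ↦ ∃ t, P t α) : ∃ t, UnboundedBelow κ (P t) := by
  by_contra! hcon
  simp only [UnboundedBelow, not_forall, exists_prop, not_exists, not_and] at hcon
  choose δ hδ hcon using hcon
  obtain ⟨α, hα, hακ, t, ht⟩ := hP (⨆ t, δ t) (iSup_lt_of_lt_cof (hκ.cof_ord.symm ▸ hT) hδ)
  exact hcon t α ((Ordinal.le_iSup δ t).trans hα) hακ ht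

theorem UnboundedBelow.mk_eq {κ : Cardinal.{0}} (hκ : κ.IsRegular) {P : Ordinal.{0} → Prop}
    (hP : UnboundedBelow κ P) : #{α | α < κ.ord ∧ P α} = Cardinal.lift.{1} κ := by
  apply le_antisymm
  · calc #{α | α < κ.ord ∧ P α} ≤ #(Iio κ.ord) := mk_le_mk_of_subset fun α hα ↦ hα.1
      _ = Cardinal.lift.{1} κ := by rw [Cardinal.mk_Iio_ordinal, card_ord]
  · by_contra! hlt
    have hX : Small.{0} {α | α < κ.ord ∧ P α} := by
      rw [small_iff_lift_mk_lt_univ]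
      simpa using hlt.trans (lift_lt_univ κ)
    have hsup : sSup ((· + 1) '' {α | α < κ.ord ∧ P α}) < κ.ord := by
      apply sSup_add_one_lt_of_lt_cof
      · simpa [hκ.lift.cof_ord] using hlt
      · exact fun α hα ↦ hα.1
    obtain ⟨α, h₁, h₂, h₃⟩ := hP _ hsup
    have : α + 1 ≤ sSup ((· + 1) '' {α | α < κ.ord ∧ P α}) :=
      le_csSup Ordinal.bddAbove_of_small (mem_image_of_mem _ ⟨h₂, h₃⟩)
    exact absurd (this.trans h₁) (not_le.2 (lt_add_one α))

section BoundingIdeal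

variable {ι : Type} (lam : ι → Cardinal.{0}) (κ : Cardinal.{0})

/-- The sets `B` of coordinates such that every `κ`-sequence in the product of the `lam i` has a
subsequence of length `κ` that is bounded on `B` by a single element of the product. -/
def BoundingSet (B : Set ι) : Prop :=
  ∀ h : Ordinal.{0} → ι → Ordinal.{0}, (∀ α < κ.ord, ∀ i, h α i < (lam i).ord) →
    ∃ g : ι → Ordinal.{0}, (∀ i, g i < (lam i).ord) ∧
      UnboundedBelow κ fun α ↦ ∀ i ∈ B, h α i ≤ g i

variable {lam κ}

theorem BoundingSet.mono {A B : Set ι} (hB : BoundingSet lam κ B) (hAB : A ⊆ B) :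
    BoundingSet lam κ A := fun h hh ↦
  let ⟨g, hg, hub⟩ := hB h hh
  ⟨g, hg, hub.mono fun _ _ hα i hi ↦ hα i (hAB hi)⟩

theorem BoundingSet.union {A B : Set ι} (hA : BoundingSet lam κ A) (hB : BoundingSet lam κ B) :
    BoundingSet lam κ (A ∪ B) := by
  intro h hh
  obtain ⟨g₁, hg₁, hub₁⟩ := hA h hh
  have hnext : ∀ δ, ∃ α, δ < κ.ord → δ ≤ α ∧ α < κ.ord ∧ ∀ i ∈ A, h α i ≤ g₁ i := by
    intro δ
    by_cases hδ : δ < κ.ord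
    · exact (hub₁ δ hδ).imp fun α hα _ ↦ hα
    · exact ⟨0, fun h ↦ absurd h hδ⟩
  choose n hn using hnext
  obtain ⟨g₂, hg₂, hub₂⟩ := hB (fun δ ↦ h (n δ)) fun α hα ↦ hh _ (hn α hα).2.1
  refine ⟨fun i ↦ max (g₁ i) (g₂ i), fun i ↦ max_lt (hg₁ i) (hg₂ i), fun δ hδ ↦ ?_⟩
  obtain ⟨α, hδα, hα, hαB⟩ := hub₂ δ hδ
  obtain ⟨hle, hlt, hαA⟩ := hn α hα
  refine ⟨n α, hδα.trans hle, hlt, ?_⟩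
  rintro i (hi | hi)
  · exact (hαA i hi).trans (le_max_left _ _)
  · exact (hαB i hi).trans (le_max_right _ _)

theorem boundingSet_empty (hpos : ∀ i, 0 < lam i) : BoundingSet lam κ ∅ := fun _ _ ↦
  ⟨fun _ ↦ 0, fun i ↦ by simpa [Cardinal.ord_pos] using hpos i,
    fun δ hδ ↦ ⟨δ, le_rfl, hδ, fun _ hi ↦ hi.elim⟩⟩

theorem boundingSet_of_prod_lt (hκ : κ.IsRegular) (hpos : ∀ i, 0 < lam i) {B : Set ι}
    (hB : Cardinal.prod (fun i : B ↦ lam i) < κ) : BoundingSet lam κ B := by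
  classical
  intro h hh
  have hT : #(∀ i : B, (lam i).ord.ToType) < κ := by simpa [mk_pi, mk_toType] using hB
  obtain ⟨t, ht⟩ := UnboundedBelow.exists_of_mk_lt hκ hT
    (P := fun t α ↦ ∀ i : B, h α i = (ToType.toOrd (t i) : Ordinal)) fun δ hδ ↦
      ⟨δ, le_rfl, hδ, fun i ↦ ToType.mk ⟨h δ i, hh δ hδ i⟩, fun i ↦ by simp⟩
  refine ⟨fun i ↦ if hi : i ∈ B then (ToType.toOrd (t ⟨i, hi⟩) : Ordinal) else 0,
    fun i ↦ ?_, ht.mono fun α _ hα i hi ↦ ?_⟩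
  · dsimp only
    split_ifs with hi
    · exact (ToType.toOrd (t ⟨i, hi⟩)).2
    · simpa [Cardinal.ord_pos] using hpos i
  · simpa [hi] using (hα ⟨i, hi⟩).le

theorem boundingSet_le_two_power (hκ : κ.IsRegular) (hpos : ∀ i, 0 < lam i)
    (hbig : 2 ^ #ι < κ) : BoundingSet lam κ {i | lam i ≤ 2 ^ #ι} := by
  refine boundingSet_of_prod_lt hκ hpos ?_
  calc Cardinal.prod (fun i : {i | lam i ≤ 2 ^ #ι} ↦ lam i)
      ≤ Cardinal.prod (fun _ : {i | lam i ≤ 2 ^ #ι} ↦ (2 : Cardinal) ^ #ι) :=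
        prod_le_prod _ _ fun i ↦ i.2
    _ = (2 ^ #ι) ^ #{i | lam i ≤ 2 ^ #ι} := by simp
    _ ≤ (2 ^ #ι) ^ #ι := power_le_power_left (power_ne_zero _ two_ne_zero) (mk_set_le _)
    _ < κ := by
      rcases lt_or_ge #ι ℵ₀ with hfin | hinf
      · exact (power_lt_aleph0 (power_lt_aleph0 (natCast_lt_aleph0 (n := 2)) hfin) hfin).trans_le
          hκ.aleph0_le
      · rwa [← power_mul, mul_eq_self hinf]

/-- A single sequence that is strongly unbounded on every large non-bounding set. -/
theorem exists_universal_sequence (hreg : ∀ i, (lam i).IsRegular) :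
    ∃ h : Ordinal.{0} → ι → Ordinal.{0}, (∀ α < κ.ord, ∀ i, h α i < (lam i).ord) ∧
      ∀ B : Set ι, ¬ BoundingSet lam κ B → (∀ i ∈ B, 2 ^ #ι < lam i) →
        ∀ g : ι → Ordinal.{0}, (∀ i, g i < (lam i).ord) →
          ¬ UnboundedBelow κ fun α ↦ ∀ i ∈ B, h α i ≤ g i := by
  classical
  have hex : ∀ B : Set ι, ∃ h : Ordinal.{0} → ι → Ordinal.{0},
      (∀ α < κ.ord, ∀ i, h α i < (lam i).ord) ∧ (¬ BoundingSet lam κ B →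
        ∀ g : ι → Ordinal.{0}, (∀ i, g i < (lam i).ord) →
          ¬ UnboundedBelow κ fun α ↦ ∀ i ∈ B, h α i ≤ g i) := by
    intro B
    by_cases hB : BoundingSet lam κ B
    · exact ⟨fun _ _ ↦ 0, fun _ _ i ↦ (hreg i).ord_pos, fun h ↦ absurd hB h⟩
    · have := hB
      simp only [BoundingSet, not_forall, not_exists, not_and] at this
      obtain ⟨h, hh, hB'⟩ := this
      exact ⟨h, hh, fun _ ↦ hB'⟩
  choose h hh hunb using hex
  refine ⟨fun α i ↦ if 2 ^ #ι < lam i then ⨆ B, h B α i else 0, fun α hα i ↦ ?_,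
    fun B hB hlarge g hg hub ↦ hunb B hB g hg (hub.mono fun α _ hα i hi ↦ ?_)⟩
  · dsimp only
    split_ifs with hi
    · exact iSup_lt_of_lt_cof (by simpa [(hreg i).cof_ord] using hi) fun B ↦ hh B α hα i
    · exact (hreg i).ord_pos
  · have := hα i hi
    simp only [if_pos (hlarge i hi)] at this
    exact (Ordinal.le_iSup (fun B ↦ h B α i) B).trans this

/-- An ultrafilter avoiding all bounding sets, when the whole index set is not bounding. -/
theorem exists_ultrafilter_not_boundingSet (hpos : ∀ i, 0 < lam i)
    (huniv : ¬ BoundingSet lam κ univ) :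
    ∃ D : Ultrafilter ι, ∀ B ∈ D, ¬ BoundingSet lam κ B := by
  let F : Filter ι := Filter.comk (BoundingSet lam κ) (boundingSet_empty hpos)
    (fun _ ht _ hst ↦ ht.mono hst) (fun _ hs _ ht ↦ hs.union ht)
  have : F.NeBot := by
    rw [Filter.neBot_iff, ne_eq, ← Filter.empty_mem_iff_bot, Filter.mem_comk]
    simpa using huniv
  refine ⟨Ultrafilter.of F, fun B hBD hB ↦ ?_⟩
  have : Bᶜ ∈ Ultrafilter.of F := Ultrafilter.of_le F (by simpa [F] using hB)
  exact Ultrafilter.compl_notMem_iff.2 hBD this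

end BoundingIdeal

/-- A sequence growing at least as fast as the identity and past `e` of each earlier term. -/
noncomputable def dominatingSequence (e : Ordinal.{0} → Ordinal.{0}) (γ : Ordinal.{0}) :
    Ordinal.{0} :=
  max γ (⨆ β : γ.ToType, e (dominatingSequence e (ToType.toOrd β)))
termination_by γ
decreasing_by exact (ToType.toOrd β).2

theorem le_dominatingSequence (e : Ordinal.{0} → Ordinal.{0}) (γ : Ordinal.{0}) :
    γ ≤ dominatingSequence e γ := by
  rw [dominatingSequence]
  exact le_max_left _ _

theorem apply_dominatingSequence_le (e : Ordinal.{0} → Ordinal.{0}) {β γ : Ordinal.{0}}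
    (h : β < γ) : e (dominatingSequence e β) ≤ dominatingSequence e γ := by
  rw [dominatingSequence.eq_1 e γ]
  refine le_max_of_le_right ?_
  simpa using Ordinal.le_iSup (fun β : γ.ToType ↦ e (dominatingSequence e (ToType.toOrd β)))
    (ToType.mk ⟨β, h⟩)

theorem dominatingSequence_lt {κ : Cardinal.{0}} (hκ : κ.IsRegular)
    {e : Ordinal.{0} → Ordinal.{0}} (he : ∀ α < κ.ord, e α < κ.ord) {γ : Ordinal.{0}}
    (hγ : γ < κ.ord) : dominatingSequence e γ < κ.ord := by
  induction γ using WellFoundedLT.induction with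
  | ind γ ih =>
    rw [dominatingSequence]
    refine max_lt hγ (iSup_lt_of_lt_cof ?_ fun β ↦ ?_)
    · rw [mk_toType, hκ.cof_ord]
      exact Cardinal.lt_ord.1 hγ
    · exact he _ (ih _ (ToType.toOrd β).2 ((ToType.toOrd β).2.trans hγ))


/-- Theorem 3.20 (pcf): if `{λ_i : i ∈ I}` are regular cardinals with
`|I| < min λ_i`, `μ` is regular with `μ > 2^{|I|}`, and `μ` is not a possible
cofinality of `∏ λ_i` (no ultrafilter `D` on `I` admits a `<_D`-increasing
`<_D`-cofinal sequence of length `μ`), then any `μ`-sequence in `∏ λ_i` has a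
subset of full size `μ` that is pointwise bounded by a single `f ∈ ∏ λ_i`. -/
theorem stmt_16 (ι : Type) (lam : ι → Cardinal)
    (hreg : ∀ i, (lam i).IsRegular)
    (hsize : ∀ i, Cardinal.mk ι < lam i)
    (μ : Cardinal) (hμ : μ.IsRegular) (hbig : 2 ^ Cardinal.mk ι < μ)
    (hnotpcf : ¬ ∃ (D : Ultrafilter ι) (F : Ordinal → ι → Ordinal),
      (∀ β < μ.ord, ∀ i, F β i < (lam i).ord) ∧
      (∀ β γ : Ordinal, β < γ → γ < μ.ord → {i | F γ i ≤ F β i} ∉ D) ∧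
      (∀ h : ι → Ordinal, (∀ i, h i < (lam i).ord) →
        ∃ β < μ.ord, {i | F β i ≤ h i} ∉ D))
    (H : Ordinal → ι → Ordinal) (hH : ∀ α < μ.ord, ∀ i, H α i < (lam i).ord) :
    ∃ X : Set Ordinal, X ⊆ Set.Iio μ.ord ∧
      Cardinal.mk ↥X = Cardinal.lift.{1} μ ∧
      ∃ f : ι → Ordinal, (∀ i, f i < (lam i).ord) ∧
        ∀ α ∈ X, ∀ i, H α i ≤ f i := by
  have hpos : ∀ i, 0 < lam i := fun i ↦ (hreg i).pos
  have huniv : BoundingSet lam μ univ := by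
    by_contra huniv
    obtain ⟨D, hD⟩ := exists_ultrafilter_not_boundingSet hpos huniv
    obtain ⟨h, hh, hunb⟩ := exists_universal_sequence (κ := μ) hreg
    have hlarge : {i | 2 ^ #ι < lam i} ∈ D := by
      have : {i | lam i ≤ 2 ^ #ι} ∉ D := fun hmem ↦
        hD _ hmem (boundingSet_le_two_power hμ hpos hbig)
      simpa [← Ultrafilter.compl_mem_iff_notMem, compl_ofPred] using this
    have hdom : ∀ g : ι → Ordinal, ∃ δ, (∀ i, g i < (lam i).ord) →
        δ < μ.ord ∧ ∀ α, δ ≤ α → α < μ.ord → {i | h α i ≤ g i} ∉ D := by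
      intro g
      by_cases hg : ∀ i, g i < (lam i).ord
      · by_contra! hcon
        have hub : UnboundedBelow μ fun α ↦
            ∃ B : Set ι, {i | h α i ≤ g i} = B ∧ B ∈ D := fun δ hδ ↦
          let ⟨α, h₁, h₂, h₃⟩ := (hcon δ).2 hδ
          ⟨α, h₁, h₂, _, rfl, h₃⟩
        obtain ⟨B, hB⟩ := UnboundedBelow.exists_of_mk_lt hμ (by simpa using hbig) hub
        obtain ⟨_, _, _, _, hBD⟩ := hB 0 hμ.ord_pos
        refine hunb (B ∩ {i | 2 ^ #ι < lam i}) (hD _ (Filter.inter_mem hBD hlarge))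
          (fun i hi ↦ hi.2) g hg (hB.mono fun α _ hα i hi ↦ ?_)
        have := hi.1
        rwa [← hα.1] at this
      · exact ⟨0, fun h ↦ absurd h hg⟩
    choose e he using hdom
    let s := dominatingSequence fun α ↦ e (h α)
    have hs : ∀ γ < μ.ord, s γ < μ.ord := fun γ hγ ↦
      dominatingSequence_lt hμ (fun α hα ↦ (he _ (hh α hα)).1) hγ
    refine hnotpcf ⟨D, fun γ ↦ h (s γ), fun β hβ ↦ hh _ (hs β hβ), fun β γ hβγ hγ ↦ ?_,
      fun g hg ↦ ⟨e g, (he g hg).1, ?_⟩⟩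
    · exact (he _ (hh _ (hs β (hβγ.trans hγ)))).2 _ (apply_dominatingSequence_le _ hβγ) (hs γ hγ)
    · exact (he g hg).2 _ (le_dominatingSequence _ _) (hs _ (he g hg).1)
  obtain ⟨f, hf, hub⟩ := huniv H hH
  exact ⟨_, fun α hα ↦ hα.1, hub.mk_eq hμ, f, hf, fun α hα i ↦ hα.2 i (mem_univ i)⟩
end
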